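/- In the presented Heisenberg algebra 𝔥, the commutation relations among the transposed elements p_i^{(1ⁿ)}, q_i^{(1ⁿ)} are the same as those among the p_i^{(n)}, q_i^{(n)}: for all i, j ∈ I and m, n ≥ 0, (a) p_i^{(1ⁿ)}·p_j^{(1ᵐ)} = p_j^{(1ᵐ)}·p_i^{(1ⁿ)} and q_i^{(1ⁿ)}·q_j^{(1ᵐ)} = q_j^{(1ᵐ)}·q_i^{(1ⁿ)}; (b) q_i^{(1ⁿ)}·p_i^{(1ᵐ)} = Σ_{k≥0} [k+1]·p_i^{(1^{m−k})}·q_i^{(1^{n−k})}; (c) if i ∼ j then q_i^{(1ⁿ)}·p_j^{(1ᵐ)} = p_j^{(1ᵐ)}·q_i^{(1ⁿ)} + p_j^{(1^{m−1})}·q_i^{(1^{n−1})}; and (d) if i ≠ j are non-adjacent then q_i^{(1ⁿ)}·p_j^{(1ᵐ)} = p_j^{(1ᵐ)}·q_i^{(1ⁿ)} (terms with negative superscripts are zero). -/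

import Mathlib

/-!
We formalize the quantum Heisenberg algebra `𝔥` associated to a simple graph with vertex
set `I` (in the paper, the affine Dynkin diagram of a nontrivial finite subgroup
`Γ ⊂ SL₂(ℂ)`, `Γ ≠ ℤ/2`), presented over `K = ℚ(t)` by generators `aᵢ(n)` (`i ∈ I`,
`n ∈ ℤ ∖ {0}`) and the relations
`aᵢ(m)aⱼ(n) = aⱼ(n)aᵢ(m)` for `m + n ≠ 0` and
`aᵢ(-n)aⱼ(n) - aⱼ(n)aᵢ(-n) = κᵢⱼ(n)·1` for `n ≥ 1`, where `κᵢᵢ(n) = -[2n][n]/n`,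
`κᵢⱼ(n) = (-1)ⁿ[n]²/n` if `i ∼ j` and `κᵢⱼ(n) = 0` otherwise.
-/

open scoped Classical

noncomputable section

/-- The base field `K = ℚ(t)`. -/
abbrev K : Type := RatFunc ℚ

/-- The variable `t ∈ K = ℚ(t)`. -/
def tv : K := RatFunc.X

/-- The quantum integer `[n] = (tⁿ - t⁻ⁿ)/(t - t⁻¹)`. -/
def qint (n : ℤ) : K := (tv ^ n - tv ^ (-n)) / (tv - tv⁻¹)

/-- The quantum integer `[k+1] = t^{-k} + t^{-k+2} + ⋯ + t^{k-2} + t^k`. -/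
def qnat (k : ℕ) : K := ∑ j ∈ Finset.range (k + 1), tv ^ (2 * (j : ℤ) - (k : ℤ))

/-- Index type for the generators `aᵢ(n)`, `i ∈ I`, `n ∈ ℤ ∖ {0}`. -/
abbrev Gen (I : Type) : Type := I × {n : ℤ // n ≠ 0}

/-- The structure constants `κᵢⱼ(n)`:  `κᵢᵢ(n) = -[2n][n]/n`,
`κᵢⱼ(n) = (-1)ⁿ[n]²/n` if `i ∼ j`, and `κᵢⱼ(n) = 0` otherwise. -/
def kappa {I : Type} (G : SimpleGraph I) (i j : I) (n : ℤ) : K :=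
  if i = j then -(qint (2 * n) * qint n / (n : K))
  else if G.Adj i j then (-1 : K) ^ n * qint n ^ 2 / (n : K)
  else 0

/-- The defining relations of the Heisenberg algebra:
`aᵢ(m)aⱼ(n) = aⱼ(n)aᵢ(m)` whenever `m + n ≠ 0`, and
`aᵢ(-n)aⱼ(n) - aⱼ(n)aᵢ(-n) = κᵢⱼ(n)·1` for all `n ≥ 1`. -/
inductive HeisRel {I : Type} (G : SimpleGraph I) :
    FreeAlgebra K (Gen I) → FreeAlgebra K (Gen I) → Prop
  | comm (i j : I) (m n : {k : ℤ // k ≠ 0}) (h : (m : ℤ) + (n : ℤ) ≠ 0) :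
      HeisRel G (FreeAlgebra.ι K (i, m) * FreeAlgebra.ι K (j, n))
        (FreeAlgebra.ι K (j, n) * FreeAlgebra.ι K (i, m))
  | heis (i j : I) (n : ℤ) (hn : 1 ≤ n) :
      HeisRel G
        (FreeAlgebra.ι K (i, ⟨-n, by omega⟩) * FreeAlgebra.ι K (j, ⟨n, by omega⟩) -
          FreeAlgebra.ι K (j, ⟨n, by omega⟩) * FreeAlgebra.ι K (i, ⟨-n, by omega⟩))
        (algebraMap K (FreeAlgebra K (Gen I)) (kappa G i j n))

/-- The Heisenberg algebra `𝔥`, presented by generators and relations. -/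
abbrev HeisAlg {I : Type} (G : SimpleGraph I) : Type := RingQuot (HeisRel G)

/-- The generators `aᵢ(n)` of `𝔥` (with the harmless convention `aᵢ(0) = 0`). -/
def aGen {I : Type} (G : SimpleGraph I) (i : I) (n : ℤ) : HeisAlg G :=
  if h : n ≠ 0 then RingQuot.mkAlgHom K (HeisRel G) (FreeAlgebra.ι K (i, ⟨n, h⟩)) else 0

/-- `p_i^{(n)}` for `n : ℕ`, defined by `p_i^{(0)} = 1` and the recursion
`n·p_i^{(n)} = Σ_{m=1}^{n} (m/[m])·aᵢ(-m)·p_i^{(n-m)}`. -/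
def pAux {I : Type} (G : SimpleGraph I) (i : I) : ℕ → HeisAlg G
  | 0 => 1
  | n + 1 =>
      (((n : K) + 1))⁻¹ • ∑ m ∈ Finset.range (n + 1),
        ((((m : K) + 1)) / qint ((m : ℤ) + 1)) •
          (aGen G i (-((m : ℤ) + 1)) * pAux G i (n - m))
  decreasing_by exact Nat.lt_succ_of_le (Nat.sub_le n m)

/-- `q_i^{(n)}` for `n : ℕ`, defined by `q_i^{(0)} = 1` and the recursion
`n·q_i^{(n)} = Σ_{m=1}^{n} (m/[m])·aᵢ(m)·q_i^{(n-m)}`. -/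
def qAux {I : Type} (G : SimpleGraph I) (i : I) : ℕ → HeisAlg G
  | 0 => 1
  | n + 1 =>
      (((n : K) + 1))⁻¹ • ∑ m ∈ Finset.range (n + 1),
        ((((m : K) + 1)) / qint ((m : ℤ) + 1)) •
          (aGen G i ((m : ℤ) + 1) * qAux G i (n - m))
  decreasing_by exact Nat.lt_succ_of_le (Nat.sub_le n m)

/-- `p_i^{(k)}` for `k : ℤ`, vanishing for `k < 0`. -/
def pH {I : Type} (G : SimpleGraph I) (i : I) (k : ℤ) : HeisAlg G :=
  if k < 0 then 0 else pAux G i k.toNat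

/-- `q_i^{(k)}` for `k : ℤ`, vanishing for `k < 0`. -/
def qH {I : Type} (G : SimpleGraph I) (i : I) (k : ℤ) : HeisAlg G :=
  if k < 0 then 0 else qAux G i k.toNat

/-- The transposed element `p_i^{(1ⁿ)}` for `n : ℕ`, defined by `p_i^{(1⁰)} = 1` and the
recursion `n·p_i^{(1ⁿ)} = Σ_{m=1}^{n} (-1)^{m+1}(m/[m])·aᵢ(-m)·p_i^{(1^{n-m})}`. -/
def pAux' {I : Type} (G : SimpleGraph I) (i : I) : ℕ → HeisAlg G
  | 0 => 1
  | n + 1 =>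
      (((n : K) + 1))⁻¹ • ∑ m ∈ Finset.range (n + 1),
        ((-1 : K) ^ m * (((m : K) + 1)) / qint ((m : ℤ) + 1)) •
          (aGen G i (-((m : ℤ) + 1)) * pAux' G i (n - m))
  decreasing_by exact Nat.lt_succ_of_le (Nat.sub_le n m)

/-- The transposed element `q_i^{(1ⁿ)}` for `n : ℕ`, defined by `q_i^{(1⁰)} = 1` and the
recursion `n·q_i^{(1ⁿ)} = Σ_{m=1}^{n} (-1)^{m+1}(m/[m])·aᵢ(m)·q_i^{(1^{n-m})}`. -/
def qAux' {I : Type} (G : SimpleGraph I) (i : I) : ℕ → HeisAlg G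
  | 0 => 1
  | n + 1 =>
      (((n : K) + 1))⁻¹ • ∑ m ∈ Finset.range (n + 1),
        ((-1 : K) ^ m * (((m : K) + 1)) / qint ((m : ℤ) + 1)) •
          (aGen G i ((m : ℤ) + 1) * qAux' G i (n - m))
  decreasing_by exact Nat.lt_succ_of_le (Nat.sub_le n m)

/-- `p_i^{(1ᵏ)}` for `k : ℤ`, vanishing for `k < 0`. -/
def pH' {I : Type} (G : SimpleGraph I) (i : I) (k : ℤ) : HeisAlg G :=
  if k < 0 then 0 else pAux' G i k.toNat

/-- `q_i^{(1ᵏ)}` for `k : ℤ`, vanishing for `k < 0`. -/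
def qH' {I : Type} (G : SimpleGraph I) (i : I) (k : ℤ) : HeisAlg G :=
  if k < 0 then 0 else qAux' G i k.toNat

open PowerSeries in
/-- The Euler operator `X · d/dX` on power series over a possibly noncommutative semiring. -/
def eulerOp {B : Type*} [Semiring B] (F : PowerSeries B) : PowerSeries B :=
  PowerSeries.mk fun n => n • coeff n F

section EulerOp

open PowerSeries

variable {B : Type*}

@[simp]
lemma coeff_eulerOp [Semiring B] (F : PowerSeries B) (n : ℕ) :
    coeff n (eulerOp F) = n • coeff n F := by
  simp [eulerOp]

lemma eulerOp_mul [Semiring B] (F H : PowerSeries B) :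
    eulerOp (F * H) = eulerOp F * H + F * eulerOp H := by
  ext n
  simp only [coeff_eulerOp, map_add, coeff_mul, Finset.smul_sum, ← Finset.sum_add_distrib]
  refine Finset.sum_congr rfl fun x hx => ?_
  rw [← Finset.HasAntidiagonal.mem_antidiagonal.mp hx, add_smul, smul_mul_assoc, mul_smul_comm]

@[simp]
lemma eulerOp_C [Semiring B] (b : B) : eulerOp (C b) = 0 := by
  ext n
  rcases n with _ | n <;> simp [coeff_C]

lemma eulerOp_sub [Ring B] (F H : PowerSeries B) :
    eulerOp (F - H) = eulerOp F - eulerOp H := by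
  ext n
  simp [smul_sub]

lemma eulerOp_X_pow [Semiring B] (k : ℕ) :
    eulerOp (X ^ k : PowerSeries B) = k • (X ^ k : PowerSeries B) := by
  ext n
  by_cases h : n = k <;> simp [-nsmul_eq_mul, map_nsmul, coeff_X_pow, h]

/-- A solution of `X F' = U F` with `U(0) = 0` is determined by its constant coefficient. -/
lemma eq_zero_of_eulerOp_eq_mul (𝕜 : Type*) [Field 𝕜] [CharZero 𝕜] [Ring B] [Module 𝕜 B]
    {U F : PowerSeries B} (hU : coeff 0 U = 0) (hF : coeff 0 F = 0)
    (h : eulerOp F = U * F) : F = 0 := by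
  ext n
  induction n using Nat.strong_induction_on with
  | _ n ih =>
    rcases Nat.eq_zero_or_pos n with rfl | hn
    · simpa using hF
    have h1 : n • coeff n F = 0 := by
      rw [← coeff_eulerOp, h, coeff_mul]
      refine Finset.sum_eq_zero fun x hx => ?_
      have hx := Finset.HasAntidiagonal.mem_antidiagonal.mp hx
      rcases Nat.eq_zero_or_pos x.1 with h0 | h0
      · rw [h0, hU, zero_mul]
      · rw [ih x.2 (by omega), map_zero, mul_zero]
    have hn' : (n : 𝕜) ≠ 0 := by exact_mod_cast hn.ne'
    rw [← Nat.cast_smul_eq_nsmul 𝕜] at h1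
    simpa [hn'] using congrArg (fun b => (n : 𝕜)⁻¹ • b) h1

end EulerOp

section ExpSeq

open PowerSeries

variable {𝕜 A : Type*} [Field 𝕜] [Ring A] [Algebra 𝕜 A]

/-- `P` is the coefficient sequence of the formal exponential of `∑ m ≥ 1, x m zᵐ / m`
when the `x m` commute; in general it is the solution of `n P n = ∑ m, x m P (n - m)`. -/
structure IsExpSeq (x P : ℕ → A) : Prop where
  zero_left : x 0 = 0
  zero_right : P 0 = 1
  euler : eulerOp (PowerSeries.mk P) = PowerSeries.mk x * PowerSeries.mk P

/-- If `y` commutes with all `x m` except for `[y, x a] = a d`, then conjugating `y` by the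
exponential series of `x` adds `d Xᵃ`. -/
lemma IsExpSeq.C_mul_mk [CharZero 𝕜] {x P : ℕ → A} (hP : IsExpSeq x P) {y : A} {a : ℕ}
    (ha : a ≠ 0) {d : 𝕜}
    (hyx : ∀ b, y * x b = x b * y + if a = b then algebraMap 𝕜 A (a * d) else 0) :
    C y * PowerSeries.mk P = PowerSeries.mk P * (C y + d • (X ^ a : PowerSeries A)) := by
  have hyX : C y * PowerSeries.mk x =
      PowerSeries.mk x * C y + a • d • (X ^ a : PowerSeries A) := by
    ext b
    by_cases h : a = b
    · subst h
      rw [map_add, map_nsmul, coeff_smul, coeff_X_pow_self, coeff_C_mul, coeff_mul_C, coeff_mk,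
        hyx, if_pos rfl, map_mul, map_natCast, nsmul_eq_mul, Algebra.smul_def, mul_one]
    · simp [-nsmul_eq_mul, map_nsmul, hyx, coeff_X_pow, h, Ne.symm h]
  have hX : PowerSeries.mk P * (d • (X ^ a : PowerSeries A)) = d • (X ^ a * PowerSeries.mk P) := by
    rw [mul_smul_comm, X_pow_mul]
  have hE : eulerOp (d • (X ^ a * PowerSeries.mk P)) =
      a • d • (X ^ a * PowerSeries.mk P) +
        PowerSeries.mk x * (d • (X ^ a * PowerSeries.mk P)) := by
    have : eulerOp (d • (X ^ a * PowerSeries.mk P)) =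
        d • eulerOp (X ^ a * PowerSeries.mk P) := by
      ext n
      simp only [coeff_eulerOp, coeff_smul]
      rw [smul_comm]
    rw [this, eulerOp_mul, eulerOp_X_pow, hP.euler, smul_add, smul_mul_assoc, smul_comm d a,
      mul_smul_comm, ← mul_assoc (X ^ a) (PowerSeries.mk x), X_pow_mul (φ := PowerSeries.mk x),
      mul_assoc]
  rw [mul_add, hX, ← sub_eq_zero, ← sub_sub]
  refine eq_zero_of_eulerOp_eq_mul 𝕜 (U := PowerSeries.mk x) (by simp [hP.zero_left]) ?_ ?_
  · simp [hP.zero_right, ha]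
  · rw [eulerOp_sub, eulerOp_sub, eulerOp_mul, eulerOp_mul, hE, hP.euler, eulerOp_C,
      ← mul_assoc (C y), hyX]
    simp only [zero_mul, zero_add, mul_zero, add_zero, add_mul, mul_sub, mul_assoc,
      smul_mul_assoc]
    abel

/-- Reordering of products of the coefficients of two exponential series whose exponents have
central commutator; `h` is the coefficient sequence of the resulting scalar exponential. -/
theorem IsExpSeq.mul_eq_sum [CharZero 𝕜] {x P y Q : ℕ → A} {d h : ℕ → 𝕜}
    (hP : IsExpSeq x P) (hQ : IsExpSeq y Q) (hh : IsExpSeq d h)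
    (hyx : ∀ a b, y a * x b = x b * y a + if a = b then algebraMap 𝕜 A (a * d a) else 0)
    (n m : ℕ) :
    Q n * P m = ∑ k ∈ Finset.range (min m n + 1), h k • (P (m - k) * Q (n - k)) := by
  set P₂ : PowerSeries (PowerSeries A) := C (PowerSeries.mk P) with hP₂
  set Q₂ : PowerSeries (PowerSeries A) := PowerSeries.mk fun n => C (Q n) with hQ₂
  set Y₂ : PowerSeries (PowerSeries A) := PowerSeries.mk fun n => C (y n) with hY₂
  set D₂ : PowerSeries (PowerSeries A) :=
    PowerSeries.mk fun n => d n • (X ^ n : PowerSeries A) with hD₂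
  set H₂ : PowerSeries (PowerSeries A) :=
    PowerSeries.mk fun n => h n • (X ^ n : PowerSeries A) with hH₂
  have hYP : Y₂ * P₂ = P₂ * (Y₂ + D₂) := by
    ext1 a
    simp only [hY₂, hP₂, hD₂, coeff_mul_C, coeff_C_mul, map_add, coeff_mk]
    rcases eq_or_ne a 0 with rfl | ha
    · simp [hQ.zero_left, hh.zero_left]
    · exact hP.C_mul_mk ha (hyx a)
  have hEQ : eulerOp Q₂ = Y₂ * Q₂ := by
    ext1 k
    have := congrArg (C (R := A)) (congrArg (coeff k) hQ.euler)
    simpa [hQ₂, hY₂, coeff_mul] using this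
  have hEH : eulerOp H₂ = D₂ * H₂ := by
    ext1 k
    have := congrArg (fun c : 𝕜 => c • (X ^ k : PowerSeries A)) (congrArg (coeff k) hh.euler)
    simp only [coeff_eulerOp, coeff_mk, coeff_mul, smul_assoc, Finset.sum_smul] at this
    simp only [coeff_eulerOp, coeff_mk, coeff_mul, hH₂, hD₂, this]
    refine Finset.sum_congr rfl fun z hz => ?_
    rw [smul_mul_smul_comm, ← pow_add, Finset.HasAntidiagonal.mem_antidiagonal.mp hz]
  have hHY : H₂ * Y₂ = Y₂ * H₂ := by
    ext1 k
    rw [coeff_mul, coeff_mul, ← Finset.Nat.sum_antidiagonal_swap]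
    refine Finset.sum_congr rfl fun z _ => ?_
    simp [hH₂, hY₂, X_pow_mul]
  have key : Q₂ * P₂ = P₂ * (H₂ * Q₂) := by
    rw [← sub_eq_zero]
    refine eq_zero_of_eulerOp_eq_mul 𝕜 (U := Y₂) (by simp [hY₂, hQ.zero_left]) ?_ ?_
    · have h0 := hh.zero_right
      simp [hQ₂, hP₂, hH₂, hQ.zero_right, h0]
    · have hEP : eulerOp P₂ = 0 := by rw [hP₂, eulerOp_C]
      rw [eulerOp_sub, eulerOp_mul, eulerOp_mul, eulerOp_mul, hEQ, hEH, hEP, mul_sub,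
        ← mul_assoc Y₂ P₂, hYP, ← mul_assoc H₂ Y₂, hHY]
      simp only [zero_mul, zero_add, mul_zero, add_zero, add_mul, mul_add, mul_assoc]
      abel
  have hc := congrArg (fun F => coeff m (coeff n F)) key
  simp only [hQ₂, hP₂, hH₂, coeff_mul_C, coeff_C_mul, coeff_mk] at hc
  rw [hc, coeff_mul n, Finset.mul_sum, map_sum,
    Finset.Nat.sum_antidiagonal_eq_sum_range_succ_mk]
  have hterm : ∀ k, coeff m (PowerSeries.mk P * (coeff k (PowerSeries.mk fun n =>
        h n • (X ^ n : PowerSeries A)) * coeff (n - k) (PowerSeries.mk fun n => C (Q n)))) =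
      if k ≤ m then h k • (P (m - k) * Q (n - k)) else 0 := by
    intro k
    rw [coeff_mk, coeff_mk, smul_mul_assoc, mul_smul_comm, coeff_smul, ← mul_assoc,
      coeff_mul_C, coeff_mul_X_pow']
    split_ifs <;> simp
  simp only [hterm]
  rw [← Finset.sum_filter]
  refine Finset.sum_congr ?_ fun _ _ => rfl
  ext k
  simp only [Finset.mem_filter, Finset.mem_range]
  omega

lemma isExpSeq_of_rec [CharZero 𝕜] {x P : ℕ → A} (hx : x 0 = 0) (hP : P 0 = 1)
    (hrec : ∀ n, P (n + 1) =
      ((n : 𝕜) + 1)⁻¹ • ∑ m ∈ Finset.range (n + 1), x (m + 1) * P (n - m)) :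
    IsExpSeq x P := by
  refine ⟨hx, hP, ?_⟩
  ext n
  rcases n with _ | n
  · simp [hx]
  · have hn : (n : 𝕜) + 1 ≠ 0 := by exact_mod_cast n.succ_ne_zero
    rw [coeff_eulerOp, coeff_mk, coeff_mul, Finset.Nat.sum_antidiagonal_succ,
      Finset.Nat.sum_antidiagonal_eq_sum_range_succ_mk, hrec, ← Nat.cast_smul_eq_nsmul 𝕜,
      Nat.cast_succ, smul_inv_smul₀ hn]
    simp [hx]

/-- The trivial exponential. -/
lemma isExpSeq_zero : IsExpSeq (fun _ => (0 : A)) (fun k => if k = 0 then 1 else 0) := by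
  refine ⟨rfl, rfl, ?_⟩
  ext n
  rcases n with _ | n <;> simp [coeff_mul]

/-- The exponential series `1 + z = exp (∑ m ≥ 1, (-1) ^ (m + 1) zᵐ / m)`. -/
lemma isExpSeq_one_add : IsExpSeq (fun m => if m = 0 then (0 : A) else (-1) ^ (m + 1))
    (fun k => if k ≤ 1 then 1 else 0) := by
  refine ⟨rfl, rfl, ?_⟩
  have h : (PowerSeries.mk fun k => if k ≤ 1 then (1 : A) else 0) = 1 + X := by
    ext n
    rcases n with _ | _ | n <;> simp [coeff_X, coeff_one]
  rw [h, mul_add, mul_one]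
  ext n
  rcases n with _ | _ | n
  · simp
  · simp [coeff_X, coeff_one, coeff_succ_mul_X]
  · simp [coeff_X, coeff_one, coeff_succ_mul_X, pow_succ]

/-- The geometric series `1 / (1 - c z) = exp (∑ m ≥ 1, cᵐ zᵐ / m)`. -/
lemma isExpSeq_geometric (c : A) :
    IsExpSeq (fun m => if m = 0 then 0 else c ^ m) (fun k => c ^ k) := by
  refine ⟨rfl, pow_zero c, ?_⟩
  ext n
  rcases n with _ | n
  · simp
  · rw [coeff_eulerOp, coeff_mul, Finset.Nat.sum_antidiagonal_succ]
    simp only [coeff_mk, Nat.succ_ne_zero, if_true, if_false, zero_mul, zero_add]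
    rw [Finset.sum_congr rfl (g := fun _ => c ^ (n + 1))]
    · simp
    · intro z hz
      rw [← pow_add, ← Finset.HasAntidiagonal.mem_antidiagonal.mp hz]
      congr 1
      omega

/-- Products of commuting scalar exponentials. -/
lemma IsExpSeq.mul {R : Type*} [CommRing R] {x P y Q : ℕ → R} (hP : IsExpSeq x P)
    (hQ : IsExpSeq y Q) :
    IsExpSeq (fun m => x m + y m)
      (fun n => ∑ z ∈ Finset.HasAntidiagonal.antidiagonal n, P z.1 * Q z.2) := by
  refine ⟨by simp [hP.zero_left, hQ.zero_left], by simp [hP.zero_right, hQ.zero_right], ?_⟩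
  have h1 : (PowerSeries.mk fun n => ∑ z ∈ Finset.HasAntidiagonal.antidiagonal n, P z.1 * Q z.2) =
      PowerSeries.mk P * PowerSeries.mk Q := by
    ext n
    simp [coeff_mul]
  have h2 : (PowerSeries.mk fun m => x m + y m) = PowerSeries.mk x + PowerSeries.mk y := by
    ext n
    simp
  rw [h1, h2, eulerOp_mul, hP.euler, hQ.euler]
  ring

end ExpSeq

lemma tv_ne_zero : tv ≠ 0 := RatFunc.X_ne_zero

lemma tv_pow_ne_one {n : ℕ} (hn : n ≠ 0) : tv ^ n ≠ 1 := by
  intro h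
  have h1 : algebraMap (Polynomial ℚ) K (Polynomial.X ^ n) = algebraMap (Polynomial ℚ) K 1 := by
    rw [map_pow, RatFunc.algebraMap_X, map_one]
    exact h
  have h2 := congrArg Polynomial.natDegree (RatFunc.algebraMap_injective ℚ h1)
  simp [hn] at h2

lemma tv_sub_inv_ne_zero : tv - tv⁻¹ ≠ 0 := by
  intro h
  refine tv_pow_ne_one two_ne_zero ?_
  rw [sub_eq_zero] at h
  rw [sq]
  nth_rewrite 2 [h]
  exact mul_inv_cancel₀ tv_ne_zero

lemma qint_natCast_ne_zero {n : ℕ} (hn : n ≠ 0) : qint n ≠ 0 := by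
  refine div_ne_zero ?_ tv_sub_inv_ne_zero
  intro h
  refine tv_pow_ne_one (n := 2 * n) (by omega) ?_
  rw [sub_eq_zero, zpow_neg, zpow_natCast] at h
  rw [two_mul, pow_add]
  nth_rewrite 2 [h]
  exact mul_inv_cancel₀ (pow_ne_zero n tv_ne_zero)

lemma qint_two_mul (n : ℤ) : qint (2 * n) = (tv ^ n + tv ^ (-n)) * qint n := by
  rw [qint, qint, ← mul_div_assoc, ← mul_neg, two_mul, two_mul, zpow_add₀ tv_ne_zero,
    zpow_add₀ tv_ne_zero]
  ring

/-- The generating function of the quantum integers is `1 / ((1 - t z) (1 - t⁻¹ z))`. -/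
lemma isExpSeq_qnat :
    IsExpSeq (fun m : ℕ => if m = 0 then (0 : K) else tv ^ m + tv⁻¹ ^ m) qnat := by
  have hd : (fun m : ℕ => if m = 0 then (0 : K) else tv ^ m + tv⁻¹ ^ m) =
      fun m => (if m = 0 then 0 else tv ^ m) + if m = 0 then 0 else tv⁻¹ ^ m := by
    funext m
    split_ifs <;> simp
  have hq : qnat = fun k =>
      ∑ z ∈ Finset.HasAntidiagonal.antidiagonal k, tv ^ z.1 * tv⁻¹ ^ z.2 := by
    funext k
    rw [Finset.Nat.sum_antidiagonal_eq_sum_range_succ_mk, qnat]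
    refine Finset.sum_congr rfl fun j hj => ?_
    have hj : j ≤ k := Nat.lt_succ_iff.mp (Finset.mem_range.mp hj)
    rw [inv_pow, ← zpow_natCast, ← zpow_natCast, ← zpow_neg, ← zpow_add₀ tv_ne_zero,
      Nat.cast_sub hj]
    congr 1
    ring
  rw [hd, hq]
  exact (isExpSeq_geometric tv).mul (isExpSeq_geometric tv⁻¹)

section Heisenberg

variable {I : Type} (G : SimpleGraph I)

lemma aGen_commute (i j : I) {m n : ℤ} (h : m + n ≠ 0) :
    aGen G i m * aGen G j n = aGen G j n * aGen G i m := by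
  unfold aGen
  split_ifs with hm hn
  · rw [← map_mul, ← map_mul]
    exact RingQuot.mkAlgHom_rel K (HeisRel.comm i j ⟨m, hm⟩ ⟨n, hn⟩ h)
  all_goals simp

lemma aGen_mul_aGen_neg (i j : I) {n : ℕ} (hn : n ≠ 0) :
    aGen G i n * aGen G j (-n) =
      aGen G j (-n) * aGen G i n - algebraMap K (HeisAlg G) (kappa G j i n) := by
  have h := RingQuot.mkAlgHom_rel K (HeisRel.heis (G := G) j i n (by omega))
  rw [map_sub, map_mul, map_mul, AlgHom.commutes] at h
  rw [← h, aGen, aGen, dif_pos (by omega), dif_pos (by omega)]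
  abel

/-- The coefficients `(-1)^{m+1} (m/[m]) a_i(s m)` of the recursions for the transposed
elements. -/
def transposedCoeff (s : ℤ) (i : I) (m : ℕ) : HeisAlg G :=
  ((-1 : K) ^ (m + 1) * m / qint m) • aGen G i (s * m)

lemma transposedCoeff_zero (s : ℤ) (i : I) : transposedCoeff G s i 0 = 0 := by
  simp [transposedCoeff]

lemma isExpSeq_pAux' (i : I) : IsExpSeq (transposedCoeff G (-1) i) (pAux' G i) := by
  refine isExpSeq_of_rec (𝕜 := K) (transposedCoeff_zero G _ i) (by rw [pAux']) fun n => ?_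
  rw [pAux']
  congr 1
  refine Finset.sum_congr rfl fun m _ => ?_
  simp [transposedCoeff, pow_succ]

lemma isExpSeq_qAux' (i : I) : IsExpSeq (transposedCoeff G 1 i) (qAux' G i) := by
  refine isExpSeq_of_rec (𝕜 := K) (transposedCoeff_zero G _ i) (by rw [qAux']) fun n => ?_
  rw [qAux']
  congr 1
  refine Finset.sum_congr rfl fun m _ => ?_
  simp [transposedCoeff, pow_succ]

lemma transposedCoeff_commute (i j : I) {s r : ℤ} {a b : ℕ} (h : s * a + r * b ≠ 0) :
    transposedCoeff G s i a * transposedCoeff G r j b =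
      transposedCoeff G r j b * transposedCoeff G s i a := by
  rw [transposedCoeff, transposedCoeff, smul_mul_smul_comm, smul_mul_smul_comm,
    aGen_commute G i j h, mul_comm]

lemma transposedCoeff_same_sign (i j : I) {s : ℤ} (hs : s ≠ 0) (a b : ℕ) :
    transposedCoeff G s i a * transposedCoeff G s j b =
      transposedCoeff G s j b * transposedCoeff G s i a := by
  rcases Nat.eq_zero_or_pos a with rfl | ha
  · simp [transposedCoeff_zero]
  · refine transposedCoeff_commute G i j ?_
    rw [← mul_add]
    exact mul_ne_zero hs (by omega)

lemma transposedCoeff_opposite_sign (i j : I) {d : ℕ → K}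
    (hd : ∀ a : ℕ, a ≠ 0 → -(a / qint a ^ 2 * kappa G j i a) = d a) (a b : ℕ) :
    transposedCoeff G 1 i a * transposedCoeff G (-1) j b =
      transposedCoeff G (-1) j b * transposedCoeff G 1 i a +
        if a = b then algebraMap K (HeisAlg G) (a * d a) else 0 := by
  rcases eq_or_ne a b with rfl | hab
  · rcases eq_or_ne a 0 with rfl | ha
    · simp [transposedCoeff_zero]
    · simp only [transposedCoeff, if_true, one_mul, neg_one_mul, smul_mul_smul_comm]
      rw [aGen_mul_aGen_neg G i j ha, smul_sub, sub_eq_add_neg, ← hd a ha]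
      congr 1
      rw [Algebra.smul_def, ← map_mul, ← map_neg]
      congr 1
      have hsq : ((-1 : K) ^ (a + 1)) * (-1) ^ (a + 1) = 1 := by
        rw [← mul_pow, neg_one_mul, neg_neg, one_pow]
      linear_combination (-(a / qint a) ^ 2 * kappa G j i a) * hsq
  · rw [if_neg hab, add_zero]
    exact transposedCoeff_commute G i j (by omega)

lemma IsExpSeq.commute_of_commute {A : Type*} [Ring A] [Algebra K A] {x P y Q : ℕ → A}
    (hP : IsExpSeq x P) (hQ : IsExpSeq y Q) (hyx : ∀ a b, y a * x b = x b * y a) (n m : ℕ) :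
    Q n * P m = P m * Q n := by
  rw [hP.mul_eq_sum hQ (isExpSeq_zero (A := K)) (by simpa using hyx) n m,
    Finset.sum_eq_single 0] <;> simp +contextual

lemma kappa_self (i : I) {a : ℕ} (ha : a ≠ 0) :
    -(a / qint a ^ 2 * kappa G i i a) = if a = 0 then (0 : K) else tv ^ a + tv⁻¹ ^ a := by
  have h1 := qint_natCast_ne_zero ha
  have h2 : (a : K) ≠ 0 := Nat.cast_ne_zero.mpr ha
  rw [kappa, if_pos rfl, if_neg ha, qint_two_mul, zpow_neg, zpow_natCast, inv_pow,
    Int.cast_natCast]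
  field_simp

lemma kappa_adj {i j : I} (hij : G.Adj i j) {a : ℕ} (ha : a ≠ 0) :
    -(a / qint a ^ 2 * kappa G j i a) = if a = 0 then (0 : K) else (-1) ^ (a + 1) := by
  have h1 := qint_natCast_ne_zero ha
  have h2 : (a : K) ≠ 0 := Nat.cast_ne_zero.mpr ha
  rw [kappa, if_neg hij.symm.ne, if_pos hij.symm, if_neg ha, zpow_natCast, Int.cast_natCast,
    pow_succ]
  field_simp
  ring

lemma pH'_natCast (i : I) (n : ℕ) : pH' G i n = pAux' G i n := by simp [pH']

lemma qH'_natCast (i : I) (n : ℕ) : qH' G i n = qAux' G i n := by simp [qH']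

end Heisenberg

/-- Section 2 of the paper: the commutation relations among the
transposed elements `p_i^{(1ⁿ)}, q_i^{(1ⁿ)}` are the same as those among the
`p_i^{(n)}, q_i^{(n)}`. -/
theorem heisenberg_rel_transposed {I : Type} (G : SimpleGraph I) :
    (∀ (i j : I) (n m : ℕ), pH' G i n * pH' G j m = pH' G j m * pH' G i n) ∧
    (∀ (i j : I) (n m : ℕ), qH' G i n * qH' G j m = qH' G j m * qH' G i n) ∧
    (∀ (i : I) (n m : ℕ),
      qH' G i n * pH' G i m =
        ∑ k ∈ Finset.range (min m n + 1),
          qnat k • (pH' G i ((m : ℤ) - (k : ℤ)) * qH' G i ((n : ℤ) - (k : ℤ)))) ∧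
    (∀ (i j : I) (n m : ℕ), G.Adj i j →
      qH' G i n * pH' G j m =
        pH' G j m * qH' G i n + pH' G j ((m : ℤ) - 1) * qH' G i ((n : ℤ) - 1)) ∧
    (∀ (i j : I) (n m : ℕ), i ≠ j → ¬ G.Adj i j →
      qH' G i n * pH' G j m = pH' G j m * qH' G i n) := by
  simp only [pH'_natCast, qH'_natCast]
  refine ⟨fun i j => (isExpSeq_pAux' G j).commute_of_commute (isExpSeq_pAux' G i)
      (transposedCoeff_same_sign G i j (by decide)),
    fun i j => (isExpSeq_qAux' G j).commute_of_commute (isExpSeq_qAux' G i)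
      (transposedCoeff_same_sign G i j (by decide)), fun i n m => ?_, fun i j n m hij => ?_,
    fun i j n m hne hij => ?_⟩
  · rw [(isExpSeq_pAux' G i).mul_eq_sum (isExpSeq_qAux' G i) isExpSeq_qnat
      (transposedCoeff_opposite_sign G i i fun a => kappa_self G i) n m]
    refine Finset.sum_congr rfl fun k hk => ?_
    have hk := Finset.mem_range.mp hk
    rw [← Nat.cast_sub (by omega), ← Nat.cast_sub (by omega), pH'_natCast, qH'_natCast]
  · rw [(isExpSeq_pAux' G j).mul_eq_sum (isExpSeq_qAux' G i) (isExpSeq_one_add (A := K))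
      (transposedCoeff_opposite_sign G i j fun a => kappa_adj G hij) n m]
    rcases m with _ | m
    · simp [pH']
    rcases n with _ | n
    · simp [qH']
    rw [Nat.succ_min_succ, Finset.sum_range_succ', Finset.sum_range_succ']
    simp [pH'_natCast, qH'_natCast, add_comm]
  · refine (isExpSeq_pAux' G j).commute_of_commute (isExpSeq_qAux' G i) (fun a b => ?_) n m
    have hk : ∀ a : ℕ, kappa G j i a = 0 := fun a => by
      rw [kappa, if_neg hne.symm, if_neg fun h => hij h.symm]
    simpa using transposedCoeff_opposite_sign G i j (d := 0) (by simp [hk]) a b
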